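/- Two TH systems Φ and Φ' over a field K are isomorphic if and only if they share the same eigenvalue sequence, dual eigenvalue sequence, and split sequence. -/

import Mathlib

/-- A thin Hessenberg system on `V`: multiplicity-free `A`, `Astar` with
orderings of primitive idempotents `E`, `Estar` (eigenvalues `θ`, `θs`)
satisfying the Hessenberg conditions. -/
structure THSystem (K V : Type*) [Field K] [AddCommGroup V] [Module K V] (d : ℕ) where
  A : Module.End K V
  Astar : Module.End K V
  E : Fin (d + 1) → Module.End K V
  Estar : Fin (d + 1) → Module.End K V
  θ : Fin (d + 1) → K
  θs : Fin (d + 1) → K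
  finrank_eq : Module.finrank K V = d + 1
  θ_inj : Function.Injective θ
  θs_inj : Function.Injective θs
  sum_E : ∑ i, E i = 1
  E_mul : ∀ i j, E i * E j = if i = j then E i else 0
  E_ne : ∀ i, E i ≠ 0
  sum_Es : ∑ i, Estar i = 1
  Es_mul : ∀ i j, Estar i * Estar j = if i = j then Estar i else 0
  Es_ne : ∀ i, Estar i ≠ 0
  A_eq : A = ∑ i, θ i • E i
  As_eq : Astar = ∑ i, θs i • Estar i
  EAsE_zero : ∀ i j : Fin (d + 1), (j : ℕ) + 1 < (i : ℕ) → E i * Astar * E j = 0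
  EAsE_ne : ∀ i j : Fin (d + 1), (i : ℕ) = (j : ℕ) + 1 → E i * Astar * E j ≠ 0
  EsAEs_zero : ∀ i j : Fin (d + 1), (j : ℕ) + 1 < (i : ℕ) → Estar i * A * Estar j = 0
  EsAEs_ne : ∀ i j : Fin (d + 1), (i : ℕ) = (j : ℕ) + 1 → Estar i * A * Estar j ≠ 0
/-- The split decomposition subspaces
`U_i = (Σ_{h ≤ i} E*_h V) ⊓ (Σ_{h ≤ d-i} E_h V)`. -/
def splitU {K V : Type*} [Field K] [AddCommGroup V] [Module K V] {d : ℕ}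
    (Φ : THSystem K V d) (i : Fin (d + 1)) : Submodule K V :=
  (⨆ h : Fin (d + 1), ⨆ _ : (h : ℕ) ≤ (i : ℕ), LinearMap.range (Φ.Estar h)) ⊓
  (⨆ h : Fin (d + 1), ⨆ _ : (h : ℕ) ≤ d - (i : ℕ), LinearMap.range (Φ.E h))
/-- `φ` is the split sequence of `Φ`:
`(A - θ_{d-i+1}) (A* - θ*_i)` acts on `U_i` as `φ_i`, for `1 ≤ i ≤ d`. -/
def IsSplitSeq {K V : Type*} [Field K] [AddCommGroup V] [Module K V] {d : ℕ}
    (Φ : THSystem K V d) (φ : Fin (d + 1) → K) : Prop :=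
  ∀ i : Fin (d + 1), ∀ hi : 1 ≤ (i : ℕ), ∀ u ∈ splitU Φ i,
    (Φ.A - Φ.θ ⟨d - (i : ℕ) + 1, by have := i.isLt; omega⟩ • (1 : Module.End K V))
      ((Φ.Astar - Φ.θs i • (1 : Module.End K V)) u) = φ i • u

namespace THSystem

variable {K V W : Type*} [Field K] [AddCommGroup V] [Module K V] [AddCommGroup W] [Module K W]
  {d : ℕ}

/-- The TH system obtained by exchanging the roles of `A` and `Astar`. -/
def dual (Φ : THSystem K V d) : THSystem K V d where
  A := Φ.Astar
  Astar := Φ.A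
  E := Φ.Estar
  Estar := Φ.E
  θ := Φ.θs
  θs := Φ.θ
  finrank_eq := Φ.finrank_eq
  θ_inj := Φ.θs_inj
  θs_inj := Φ.θ_inj
  sum_E := Φ.sum_Es
  E_mul := Φ.Es_mul
  E_ne := Φ.Es_ne
  sum_Es := Φ.sum_E
  Es_mul := Φ.E_mul
  Es_ne := Φ.E_ne
  A_eq := Φ.As_eq
  As_eq := Φ.A_eq
  EAsE_zero := Φ.EsAEs_zero
  EAsE_ne := Φ.EsAEs_ne
  EsAEs_zero := Φ.EAsE_zero
  EsAEs_ne := Φ.EAsE_ne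

section Idempotents

variable (Φ : THSystem K V d)

theorem sum_E_apply (x : V) : ∑ i, Φ.E i x = x := by
  simpa using LinearMap.congr_fun Φ.sum_E x

theorem E_E_apply (i j : Fin (d + 1)) (x : V) :
    Φ.E i (Φ.E j x) = if i = j then Φ.E i x else 0 := by
  have h := LinearMap.congr_fun (Φ.E_mul i j) x
  rw [Module.End.mul_apply] at h
  rw [h]
  split_ifs <;> rfl

theorem E_A_apply (i : Fin (d + 1)) (x : V) : Φ.E i (Φ.A x) = Φ.θ i • Φ.E i x := by
  simp [Φ.A_eq, LinearMap.sum_apply, E_E_apply]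

theorem A_E_apply (i : Fin (d + 1)) (x : V) : Φ.A (Φ.E i x) = Φ.θ i • Φ.E i x := by
  rw [Φ.A_eq]
  simp only [LinearMap.sum_apply, LinearMap.smul_apply, E_E_apply, smul_ite, smul_zero,
    Finset.sum_ite_eq', Finset.mem_univ, if_true]

theorem eq_zero_of_forall_E {x : V} (h : ∀ i, Φ.E i x = 0) : x = 0 := by
  rw [← Φ.sum_E_apply x]
  exact Finset.sum_eq_zero fun i _ => h i

theorem mem_iSup_range_E_iff (k : ℕ) (x : V) :
    x ∈ (⨆ h : Fin (d + 1), ⨆ _ : (h : ℕ) ≤ k, LinearMap.range (Φ.E h)) ↔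
      ∀ h : Fin (d + 1), k < h → Φ.E h x = 0 := by
  constructor
  · intro hx h hk
    have hle : (⨆ h : Fin (d + 1), ⨆ _ : (h : ℕ) ≤ k, LinearMap.range (Φ.E h)) ≤
        LinearMap.ker (Φ.E h) := by
      refine iSup_le fun j => iSup_le fun hj => ?_
      rintro _ ⟨y, rfl⟩
      have hne : h ≠ j := by rintro rfl; omega
      simp [E_E_apply, hne]
    exact hle hx
  · intro hx
    rw [← Φ.sum_E_apply x]
    refine Submodule.sum_mem _ fun h _ => ?_
    by_cases hk : (h : ℕ) ≤ k
    · exact Submodule.mem_iSup_of_mem h (Submodule.mem_iSup_of_mem hk ⟨x, rfl⟩)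
    · rw [hx h (by omega)]
      exact Submodule.zero_mem _

theorem exists_E_apply_ne (i : Fin (d + 1)) : ∃ x, Φ.E i x ≠ 0 := by
  by_contra! h
  exact Φ.E_ne i (LinearMap.ext h)

/-- A family which is triangular with nonzero diagonal with respect to the idempotents
is linearly independent. -/
theorem linearIndependent_of_triangular {u : Fin (d + 1) → V}
    (hz : ∀ n h : Fin (d + 1), n < h → Φ.E h (u n) = 0) (hne : ∀ n, Φ.E n (u n) ≠ 0) :
    LinearIndependent K u := by
  rw [Fintype.linearIndependent_iff]
  classical
  intro c hc
  by_contra! hex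
  obtain ⟨i, hi, hmax⟩ := Finset.exists_max_image (Finset.univ.filter fun i => c i ≠ 0) id
    (by obtain ⟨i, hi⟩ := hex; exact ⟨i, by simpa using hi⟩)
  have h := congrArg (Φ.E i) hc
  rw [map_sum, map_zero, Finset.sum_eq_single i] at h
  · rw [map_smul] at h
    rcases smul_eq_zero.1 h with h | h
    · exact (Finset.mem_filter.1 hi).2 h
    · exact hne i h
  · intro j _ hj
    rw [map_smul]
    rcases lt_or_gt_of_ne hj with hlt | hgt
    · rw [hz j i hlt, smul_zero]
    · have : c j = 0 := by
        by_contra hcj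
        exact absurd (hmax j (by simpa using hcj)) (not_le.2 hgt)
      rw [this, zero_smul]
  · simp

/-- Every primitive idempotent has rank one. -/
theorem exists_smul_E_apply (i : Fin (d + 1)) {x : V} (hx : Φ.E i x ≠ 0) (z : V) :
    ∃ c : K, Φ.E i z = c • Φ.E i x := by
  choose y hy using Φ.exists_E_apply_ne
  have hli : LinearIndependent K fun j => Φ.E j (y j) := by
    refine Φ.linearIndependent_of_triangular (fun n h hlt => ?_) fun n => ?_
    · rw [E_E_apply, if_neg hlt.ne']
    · rw [E_E_apply, if_pos rfl]
      exact hy n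
  let b := basisOfLinearIndependentOfCardEqFinrank hli (by simp [Φ.finrank_eq])
  have key : ∀ w, Φ.E i w = b.repr w i • Φ.E i (y i) := by
    intro w
    conv_lhs => rw [← b.sum_repr w]
    simp only [b, coe_basisOfLinearIndependentOfCardEqFinrank, map_sum, map_smul, E_E_apply,
      smul_ite, smul_zero, Finset.sum_ite_eq, Finset.mem_univ, if_true]
  have hcx : b.repr x i ≠ 0 := by
    intro h0
    apply hx
    rw [key, h0, zero_smul]
  refine ⟨b.repr z i / b.repr x i, ?_⟩
  rw [key z, key x, smul_smul, div_mul_cancel₀ _ hcx]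

theorem E_Astar_apply_eq_zero {k : ℕ} {x : V} (hx : ∀ h : Fin (d + 1), k < h → Φ.E h x = 0)
    (i : Fin (d + 1)) (hi : k + 1 < i) : Φ.E i (Φ.Astar x) = 0 := by
  rw [← Φ.sum_E_apply x, map_sum, map_sum]
  refine Finset.sum_eq_zero fun j _ => ?_
  by_cases hj : k < j
  · rw [hx j hj, map_zero, map_zero]
  · exact LinearMap.congr_fun (Φ.EAsE_zero i j (by omega)) x

theorem E_Astar_apply_ne_zero {x : V} (k i : Fin (d + 1)) (hi : (i : ℕ) = k + 1)
    (hx : ∀ h : Fin (d + 1), k < h → Φ.E h x = 0) (hk : Φ.E k x ≠ 0) :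
    Φ.E i (Φ.Astar x) ≠ 0 := by
  have heq : Φ.E i (Φ.Astar x) = Φ.E i (Φ.Astar (Φ.E k x)) := by
    conv_lhs => rw [← Φ.sum_E_apply x, map_sum, map_sum]
    refine Finset.sum_eq_single k (fun j _ hj => ?_) (by simp)
    rcases lt_or_gt_of_ne hj with hlt | hgt
    · exact LinearMap.congr_fun (Φ.EAsE_zero i j (by omega)) x
    · rw [hx j hgt, map_zero, map_zero]
  rw [heq]
  intro h0
  refine Φ.EAsE_ne i k hi (LinearMap.ext fun z => ?_)
  obtain ⟨c, hc⟩ := Φ.exists_smul_E_apply k hk z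
  simp [Module.End.mul_apply, hc, h0]

theorem eq_zero_of_Astar_apply_eq_smul {k : ℕ} (hk : k < d) {x : V}
    (hx : ∀ h : Fin (d + 1), k < h → Φ.E h x = 0) {t : K} (ht : Φ.Astar x = t • x) : x = 0 := by
  classical
  by_contra hne
  have hex : ∃ i, Φ.E i x ≠ 0 := by
    by_contra! h
    exact hne (Φ.eq_zero_of_forall_E h)
  obtain ⟨i, hi, hmax⟩ := Finset.exists_max_image (Finset.univ.filter fun i => Φ.E i x ≠ 0) id
    (by obtain ⟨i, hi⟩ := hex; exact ⟨i, by simpa using hi⟩)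
  have hi := (Finset.mem_filter.1 hi).2
  have hz : ∀ h : Fin (d + 1), i < h → Φ.E h x = 0 := by
    intro h hlt
    by_contra hh
    exact absurd (hmax h (by simpa using hh)) (not_le.2 hlt)
  have hik : (i : ℕ) ≤ k := by
    by_contra hlt
    exact hi (hx i (by omega))
  have h1 := Φ.E_Astar_apply_ne_zero i ⟨i + 1, by omega⟩ rfl hz hi
  rw [ht, map_smul, hz _ (Fin.lt_def.2 (Nat.lt_succ_self _)), smul_zero] at h1
  exact h1 rfl

end Idempotents

theorem mem_splitU_iff (Φ : THSystem K V d) (i : Fin (d + 1)) (x : V) :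
    x ∈ splitU Φ i ↔ (∀ h : Fin (d + 1), (i : ℕ) < h → Φ.Estar h x = 0) ∧
      ∀ h : Fin (d + 1), d - (i : ℕ) < h → Φ.E h x = 0 := by
  rw [splitU, Submodule.mem_inf, Φ.mem_iSup_range_E_iff]
  exact and_congr_left' (Φ.dual.mem_iSup_range_E_iff i x)

/-- The vectors `(A - θ_{d-n+1}) ⋯ (A - θ_d) x`. -/
def splitVec (Φ : THSystem K V d) (x : V) : ℕ → V
  | 0 => x
  | n + 1 => Φ.A (splitVec Φ x n) - Φ.θ ⟨d - n, by omega⟩ • splitVec Φ x n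

section SplitVec

variable (Φ : THSystem K V d) {x : V}

theorem A_splitVec (x : V) (n : ℕ) :
    Φ.A (Φ.splitVec x n) = Φ.θ ⟨d - n, by omega⟩ • Φ.splitVec x n + Φ.splitVec x (n + 1) := by
  simp [splitVec]

theorem E_splitVec (x : V) (n : ℕ) :
    ∀ h : Fin (d + 1), d < n + h → Φ.E h (Φ.splitVec x n) = 0 := by
  induction n with
  | zero => intro h hh; omega
  | succ n ih =>
    intro h hh
    rw [splitVec, map_sub, map_smul, E_A_apply]
    by_cases hn : d < n + h
    · simp [ih h hn]
    · have : (⟨d - n, by omega⟩ : Fin (d + 1)) = h := Fin.ext (by simp; omega)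
      rw [this, sub_self]

theorem splitVec_eq_zero (x : V) : Φ.splitVec x (d + 1) = 0 :=
  Φ.eq_zero_of_forall_E fun h => Φ.E_splitVec x (d + 1) h (by omega)

theorem Estar_splitVec (hx : ∀ h : Fin (d + 1), 0 < (h : ℕ) → Φ.Estar h x = 0) (n : ℕ) :
    ∀ h : Fin (d + 1), n < h → Φ.Estar h (Φ.splitVec x n) = 0 := by
  induction n with
  | zero => exact hx
  | succ n ih =>
    intro h hh
    rw [splitVec, map_sub, map_smul, ih h (by omega), smul_zero, sub_zero]
    exact Φ.dual.E_Astar_apply_eq_zero ih h hh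

theorem Estar_splitVec_ne (hx : ∀ h : Fin (d + 1), 0 < (h : ℕ) → Φ.Estar h x = 0)
    (hx0 : Φ.Estar 0 x ≠ 0) (n : ℕ) (hn : n < d + 1) :
    Φ.Estar ⟨n, hn⟩ (Φ.splitVec x n) ≠ 0 := by
  induction n with
  | zero => exact hx0
  | succ n ih =>
    rw [splitVec, map_sub, map_smul,
      Φ.Estar_splitVec hx n ⟨n + 1, hn⟩ (Nat.lt_succ_self n), smul_zero, sub_zero]
    exact Φ.dual.E_Astar_apply_ne_zero ⟨n, by omega⟩ ⟨n + 1, hn⟩ rfl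
      (fun h hh => Φ.Estar_splitVec hx n h hh) (ih (by omega))

theorem splitVec_mem_splitU (hx : ∀ h : Fin (d + 1), 0 < (h : ℕ) → Φ.Estar h x = 0)
    (i : Fin (d + 1)) : Φ.splitVec x i ∈ splitU Φ i :=
  (Φ.mem_splitU_iff i _).2
    ⟨Φ.Estar_splitVec hx i, fun h hh => Φ.E_splitVec x i h (by omega)⟩

theorem Astar_splitVec_zero (hx : ∀ h : Fin (d + 1), 0 < (h : ℕ) → Φ.Estar h x = 0) :
    Φ.Astar x = Φ.θs 0 • x := by
  have hx' : Φ.Estar 0 x = x := by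
    conv_rhs => rw [← Φ.dual.sum_E_apply x]
    refine Eq.symm (Finset.sum_eq_single (0 : Fin (d + 1)) (fun j _ hj => ?_) (by simp))
    exact hx j (Nat.pos_of_ne_zero fun h => hj (Fin.ext h))
  rw [← hx']
  exact Φ.dual.A_E_apply 0 x

theorem Astar_splitVec_succ (hx : ∀ h : Fin (d + 1), 0 < (h : ℕ) → Φ.Estar h x = 0)
    {φ : Fin (d + 1) → K} (hφ : IsSplitSeq Φ φ) (n : ℕ) (hn : n + 1 < d + 1) :
    Φ.Astar (Φ.splitVec x (n + 1)) =
      Φ.θs ⟨n + 1, hn⟩ • Φ.splitVec x (n + 1) + φ ⟨n + 1, hn⟩ • Φ.splitVec x n := by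
  have h := hφ ⟨n + 1, hn⟩ (by simp) _ (Φ.splitVec_mem_splitU hx ⟨n + 1, hn⟩)
  have hidx : (⟨d - (n + 1) + 1, by omega⟩ : Fin (d + 1)) = ⟨d - n, by omega⟩ :=
    Fin.ext (by simp; omega)
  simp only [hidx, LinearMap.sub_apply, LinearMap.smul_apply, Module.End.one_apply] at h
  have hA := Φ.A_splitVec x n
  rw [← sub_eq_zero, ← sub_sub]
  refine Φ.dual.eq_zero_of_Astar_apply_eq_smul (k := n) (t := Φ.θ ⟨d - n, by omega⟩)
    (by omega) (fun i hi => ?_) ?_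
  · change Φ.Estar i _ = 0
    rw [map_sub, map_sub, map_smul, map_smul, Φ.Estar_splitVec hx n i hi, smul_zero, sub_zero]
    have hE : Φ.Estar i (Φ.Astar (Φ.splitVec x (n + 1))) =
        Φ.θs i • Φ.Estar i (Φ.splitVec x (n + 1)) := Φ.dual.E_A_apply i _
    rw [hE]
    by_cases hi' : n + 1 < i
    · simp [Φ.Estar_splitVec hx (n + 1) i hi']
    · have : i = ⟨n + 1, hn⟩ := Fin.ext (by simp; omega)
      rw [this, sub_self]
  · change Φ.A _ = _
    rw [map_sub _ _ (φ _ • _), map_smul _ (φ _), hA, smul_sub, smul_add, ← h, smul_comm (φ _)]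
    abel

theorem exists_ne_Estar_eq_zero :
    ∃ x : V, (∀ h : Fin (d + 1), 0 < (h : ℕ) → Φ.Estar h x = 0) ∧ Φ.Estar 0 x ≠ 0 := by
  obtain ⟨y, hy⟩ := Φ.dual.exists_E_apply_ne 0
  refine ⟨Φ.Estar 0 y, fun h hh => ?_, ?_⟩
  · exact (Φ.dual.E_E_apply h 0 y).trans (if_neg fun h0 => by simp [h0] at hh)
  · rwa [show Φ.Estar 0 (Φ.Estar 0 y) = Φ.Estar 0 y from
      (Φ.dual.E_E_apply 0 0 y).trans (if_pos rfl)]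

/-- The vectors `splitVec` form a basis. -/
theorem exists_basis_splitVec (hx : ∀ h : Fin (d + 1), 0 < (h : ℕ) → Φ.Estar h x = 0)
    (hx0 : Φ.Estar 0 x ≠ 0) :
    ∃ b : Module.Basis (Fin (d + 1)) K V, ∀ i, b i = Φ.splitVec x i := by
  have hli : LinearIndependent K fun i : Fin (d + 1) => Φ.splitVec x i :=
    Φ.dual.linearIndependent_of_triangular (fun n h hlt => Φ.Estar_splitVec hx n h hlt)
      fun n => Φ.Estar_splitVec_ne hx hx0 n n.isLt
  exact ⟨basisOfLinearIndependentOfCardEqFinrank hli (by simp [Φ.finrank_eq]), fun i => by simp⟩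

end SplitVec

section Isomorphism

variable (Φ : THSystem K V d) (Ψ : THSystem K W d)

theorem map_E_apply (γ : V →ₗ[K] W) (hθ : Φ.θ = Ψ.θ) (hA : ∀ x, γ (Φ.A x) = Ψ.A (γ x))
    (i : Fin (d + 1)) (x : V) : γ (Φ.E i x) = Ψ.E i (γ x) := by
  have hoff : ∀ i j, j ≠ i → Ψ.E j (γ (Φ.E i x)) = 0 := by
    intro i j hj
    have h := Ψ.E_A_apply j (γ (Φ.E i x))
    rw [← hA, A_E_apply, map_smul, map_smul, hθ, ← sub_eq_zero, ← sub_smul] at h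
    exact (smul_eq_zero.1 h).resolve_left (sub_ne_zero.2 fun h' => hj (Ψ.θ_inj h').symm)
  have h1 : Ψ.E i (γ (Φ.E i x)) = γ (Φ.E i x) := by
    conv_rhs => rw [← Ψ.sum_E_apply (γ (Φ.E i x))]
    exact (Finset.sum_eq_single i (fun j _ hj => hoff i j hj) (by simp)).symm
  have h2 : Ψ.E i (γ x) = Ψ.E i (γ (Φ.E i x)) := by
    conv_lhs => rw [← Φ.sum_E_apply x, map_sum, map_sum]
    exact Finset.sum_eq_single i (fun j _ hj => hoff j i hj.symm) (by simp)
  rw [h2, h1]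

theorem θ_eq_of_intertwining (γ : V ≃ₗ[K] W) (hA : ∀ x, γ (Φ.A x) = Ψ.A (γ x))
    (hE : ∀ i x, γ (Φ.E i x) = Ψ.E i (γ x)) : Φ.θ = Ψ.θ := by
  funext i
  obtain ⟨x, hx⟩ := Φ.exists_E_apply_ne i
  have h := hA (Φ.E i x)
  rw [A_E_apply, map_smul, hE, A_E_apply] at h
  refine smul_left_injective K ?_ h
  rw [← hE]
  simpa using hx

end Isomorphism

end THSystem

/-- Two TH systems are isomorphic iff they share the same eigenvalue sequence,
dual eigenvalue sequence, and split sequence. -/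
theorem thSystem_isomorphic_iff_same_parameters {K V W : Type*} [Field K]
    [AddCommGroup V] [Module K V] [AddCommGroup W] [Module K W] {d : ℕ}
    (Φ : THSystem K V d) (Ψ : THSystem K W d)
    (φ ψ : Fin (d + 1) → K) (hφ : IsSplitSeq Φ φ) (hψ : IsSplitSeq Ψ ψ) :
    (∃ γ : V ≃ₗ[K] W,
        (∀ x, γ (Φ.A x) = Ψ.A (γ x)) ∧ (∀ x, γ (Φ.Astar x) = Ψ.Astar (γ x)) ∧
        (∀ i x, γ (Φ.E i x) = Ψ.E i (γ x)) ∧ (∀ i x, γ (Φ.Estar i x) = Ψ.Estar i (γ x))) ↔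
      (Φ.θ = Ψ.θ ∧ Φ.θs = Ψ.θs ∧ ∀ i : Fin (d + 1), 1 ≤ (i : ℕ) → φ i = ψ i) := by
  constructor
  · rintro ⟨γ, hA, hAs, hE, hEs⟩
    have hθ := Φ.θ_eq_of_intertwining Ψ γ hA hE
    have hθs : Φ.θs = Ψ.θs := Φ.dual.θ_eq_of_intertwining Ψ.dual γ hAs hEs
    refine ⟨hθ, hθs, fun i hi => ?_⟩
    obtain ⟨x, hx, hx0⟩ := Φ.exists_ne_Estar_eq_zero
    have hu := Φ.splitVec_mem_splitU hx i
    have hne : Φ.splitVec x i ≠ 0 := fun h0 =>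
      Φ.Estar_splitVec_ne hx hx0 i i.isLt (by rw [h0, map_zero])
    have hγu : γ (Φ.splitVec x i) ∈ splitU Ψ i := by
      rw [THSystem.mem_splitU_iff] at hu ⊢
      exact ⟨fun h hh => by rw [← hEs, hu.1 h hh, map_zero],
        fun h hh => by rw [← hE, hu.2 h hh, map_zero]⟩
    have h1 := congrArg γ (hφ i hi _ hu)
    have h2 := hψ i hi _ hγu
    simp only [LinearMap.sub_apply, LinearMap.smul_apply, Module.End.one_apply, map_sub, map_smul,
      hA, hAs, hθ, hθs] at h1 h2
    exact smul_left_injective K (γ.map_ne_zero_iff.2 hne) (h1.symm.trans h2)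
  · rintro ⟨hθ, hθs, hφψ⟩
    obtain ⟨x, hx, hx0⟩ := Φ.exists_ne_Estar_eq_zero
    obtain ⟨y, hy, hy0⟩ := Ψ.exists_ne_Estar_eq_zero
    obtain ⟨b, hb⟩ := Φ.exists_basis_splitVec hx hx0
    obtain ⟨c, hc⟩ := Ψ.exists_basis_splitVec hy hy0
    let γ : V ≃ₗ[K] W := b.equiv c (Equiv.refl _)
    have hγ : ∀ n < d + 1, γ (Φ.splitVec x n) = Ψ.splitVec y n := by
      intro n hn
      have h : γ (b ⟨n, hn⟩) = c ⟨n, hn⟩ := by simp [γ]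
      rwa [hb, hc] at h
    have hA : ∀ z, γ (Φ.A z) = Ψ.A (γ z) := by
      refine LinearMap.congr_fun (f := γ.toLinearMap ∘ₗ Φ.A) (g := Ψ.A ∘ₗ γ.toLinearMap)
        (b.ext fun i => ?_)
      change γ (Φ.A (b i)) = Ψ.A (γ (b i))
      rw [hb, hγ i i.isLt, Φ.A_splitVec, Ψ.A_splitVec, map_add, map_smul, hγ i i.isLt, hθ]
      congr 1
      by_cases hi : (i : ℕ) + 1 < d + 1
      · exact hγ _ hi
      · rw [show (i : ℕ) + 1 = d + 1 by omega, Φ.splitVec_eq_zero, Ψ.splitVec_eq_zero, map_zero]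
    have hAs : ∀ z, γ (Φ.Astar z) = Ψ.Astar (γ z) := by
      refine LinearMap.congr_fun (f := γ.toLinearMap ∘ₗ Φ.Astar) (g := Ψ.Astar ∘ₗ γ.toLinearMap)
        (b.ext fun i => ?_)
      change γ (Φ.Astar (b i)) = Ψ.Astar (γ (b i))
      rw [hb, hγ i i.isLt]
      obtain ⟨n, hn⟩ := i
      cases n with
      | zero =>
        have h0 := hγ 0 hn
        simp only [THSystem.splitVec] at h0 ⊢
        rw [Φ.Astar_splitVec_zero hx, Ψ.Astar_splitVec_zero hy, map_smul, h0, hθs]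
      | succ n =>
        simp only
        rw [Φ.Astar_splitVec_succ hx hφ n hn, Ψ.Astar_splitVec_succ hy hψ n hn, map_add, map_smul,
          map_smul, hγ _ hn, hγ n (by omega), hθs, hφψ _ (by simp)]
    exact ⟨γ, hA, hAs, Φ.map_E_apply Ψ γ hθ hA, Φ.dual.map_E_apply Ψ.dual γ hθs hAs⟩
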